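/- For n ≥ 2 and s ∈ (0,1), ∫_{B₁^{n−1}} ∫_{ℝ^{n−1} \ B₁^{n−1}} |x' − y'|^{1−n−s} dy' dx' ≥ (c_n / (s(1−s))) for some constant c_n > 0 depending only on n, where B₁^{n−1} is the unit ball in ℝ^{n−1}. -/

import Mathlib

open MeasureTheory Set Real

theorem lintegral_lintegral_compl_sub {E : Type*} [AddCommGroup E] [MeasurableSpace E]
    [MeasurableAdd₂ E] [MeasurableNeg E] (μ : Measure E) [SFinite μ] [μ.IsAddLeftInvariant]
    {A : Set E} (hA : MeasurableSet A) {g : E → ENNReal} (hg : Measurable g) :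
    ∫⁻ x in A, ∫⁻ y in Aᶜ, g (y - x) ∂μ ∂μ = ∫⁻ z, g z * μ {x ∈ A | x + z ∉ A} ∂μ := by
  have hS : MeasurableSet {p : E × E | p.1 ∈ A ∧ p.1 + p.2 ∉ A} :=
    (measurable_fst hA).inter (measurable_add hA.compl)
  calc ∫⁻ x in A, ∫⁻ y in Aᶜ, g (y - x) ∂μ ∂μ
      = ∫⁻ x, ∫⁻ z, {p : E × E | p.1 ∈ A ∧ p.1 + p.2 ∉ A}.indicator (fun p ↦ g p.2) (x, z)
          ∂μ ∂μ := by
        rw [← lintegral_indicator hA]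
        refine lintegral_congr fun x ↦ ?_
        by_cases hx : x ∈ A
        · rw [indicator_of_mem hx, ← lintegral_indicator hA.compl,
            ← lintegral_add_left_eq_self _ x]
          refine lintegral_congr fun z ↦ ?_
          by_cases hz : x + z ∈ A <;> simp [indicator, hx, hz]
        · simp [hx]
    _ = ∫⁻ z, ∫⁻ x, {p : E × E | p.1 ∈ A ∧ p.1 + p.2 ∉ A}.indicator (fun p ↦ g p.2) (x, z)
          ∂μ ∂μ :=
        lintegral_lintegral_swap ((hg.comp measurable_snd).indicator hS).aemeasurable
    _ = _ := by
        refine lintegral_congr fun z ↦ ?_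
        exact lintegral_indicator_const (measurable_prodMk_right hS) (g z)

theorem measure_exit_nsmul_le {E : Type*} [AddCommGroup E] [MeasurableSpace E]
    [MeasurableAdd E] (μ : Measure E) [μ.IsAddLeftInvariant] (A : Set E) (z : E) (k : ℕ) :
    μ {x ∈ A | x + k • z ∉ A} ≤ k * μ {x ∈ A | x + z ∉ A} := by
  induction k with
  | zero => simp
  | succ k ih =>
    have hsub : {x ∈ A | x + (k + 1) • z ∉ A} ⊆
        {x ∈ A | x + k • z ∉ A} ∪ (fun x ↦ k • z + x) ⁻¹' {x ∈ A | x + z ∉ A} := by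
      rintro x ⟨hx, hxk⟩
      by_cases h : x + k • z ∈ A
      · right
        refine ⟨by simpa [add_comm] using h, ?_⟩
        convert hxk using 2
        simp [succ_nsmul]; abel
      · exact Or.inl ⟨hx, h⟩
    calc _ ≤ _ := measure_mono hsub
      _ ≤ _ := measure_union_le _ _
      _ ≤ k * μ {x ∈ A | x + z ∉ A} + μ {x ∈ A | x + z ∉ A} := by
        rw [measure_preimage_add]; gcongr
      _ = _ := by push_cast; ring

section

variable {E : Type*} [NormedAddCommGroup E] [NormedSpace ℝ E]
  [MeasurableSpace E] [BorelSpace E] (μ : Measure E) [μ.IsAddHaarMeasure]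

theorem le_measure_exit_ball (z : E) :
    ENNReal.ofReal (min 1 ‖z‖ / 3) * μ (Metric.ball 0 1) ≤
      μ {x ∈ Metric.ball (0 : E) 1 | x + z ∉ Metric.ball (0 : E) 1} := by
  rcases eq_or_ne z 0 with rfl | hz
  · simp
  have hz : 0 < ‖z‖ := norm_pos_iff.2 hz
  set k := ⌈2 / ‖z‖⌉₊
  have hk : 2 ≤ k * ‖z‖ := (div_le_iff₀ hz).1 (Nat.le_ceil _)
  have hk' : k * (min 1 ‖z‖ / 3) ≤ 1 := by
    have h1 : (k : ℝ) < 2 / ‖z‖ + 1 := Nat.ceil_lt_add_one (by positivity)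
    have h2 : k * ‖z‖ ≤ 2 + ‖z‖ := by
      have := mul_le_mul_of_nonneg_right h1.le hz.le
      rwa [add_mul, div_mul_cancel₀ _ hz.ne', one_mul] at this
    rcases le_total 1 ‖z‖ with h | h
    · rw [min_eq_left h]
      have : 2 / ‖z‖ ≤ 2 := div_le_self (by norm_num) h
      linarith
    · rw [min_eq_right h]; linarith
  have hball : Metric.ball (0 : E) 1 ⊆
      {x ∈ Metric.ball (0 : E) 1 | x + k • z ∉ Metric.ball (0 : E) 1} := by
    intro x hx
    refine ⟨hx, fun h ↦ ?_⟩
    rw [mem_ball_zero_iff] at hx h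
    have h3 := norm_sub_le (x + k • z) x
    have h4 : ‖k • z‖ = k * ‖z‖ := by
      rw [← Nat.cast_smul_eq_nsmul ℝ, norm_smul, Real.norm_natCast]
    rw [add_sub_cancel_left, h4] at h3
    linarith
  calc _ ≤ ENNReal.ofReal (min 1 ‖z‖ / 3) * (k * μ {x ∈ Metric.ball (0 : E) 1 |
        x + z ∉ Metric.ball (0 : E) 1}) := by
        gcongr
        exact (measure_mono hball).trans (measure_exit_nsmul_le μ _ z k)
    _ = ENNReal.ofReal (k * (min 1 ‖z‖ / 3)) * μ {x ∈ Metric.ball (0 : E) 1 |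
        x + z ∉ Metric.ball (0 : E) 1} := by
        rw [ENNReal.ofReal_mul (by positivity), ENNReal.ofReal_natCast]; ring
    _ ≤ 1 * _ := by gcongr; exact ENNReal.ofReal_le_one.2 hk'
    _ = _ := one_mul _

variable [FiniteDimensional ℝ E]

theorem measure_exit_ball_le [Nontrivial E] (z : E) :
    μ {x ∈ Metric.ball (0 : E) 1 | x + z ∉ Metric.ball (0 : E) 1} ≤
      ENNReal.ofReal (Module.finrank ℝ E * min 1 ‖z‖) * μ (Metric.ball 0 1) := by
  have hd : (1 : ℝ) ≤ Module.finrank ℝ E := by exact_mod_cast Module.finrank_pos (R := ℝ) (M := E)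
  rcases le_total 1 ‖z‖ with h | h
  · rw [min_eq_left h, mul_one]
    calc _ ≤ 1 * μ (Metric.ball (0 : E) 1) := by rw [one_mul]; exact measure_mono fun x hx ↦ hx.1
      _ ≤ _ := by gcongr; exact ENNReal.one_le_ofReal.2 hd
  · rw [min_eq_right h]
    have hsub : {x ∈ Metric.ball (0 : E) 1 | x + z ∉ Metric.ball (0 : E) 1} ⊆
        Metric.ball 0 1 \ Metric.ball 0 (1 - ‖z‖) := by
      rintro x ⟨hx, hxz⟩
      refine ⟨hx, fun h' ↦ hxz ?_⟩
      rw [mem_ball_zero_iff] at *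
      linarith [norm_add_le x z]
    calc _ ≤ _ := measure_mono hsub
      _ = μ (Metric.ball 0 1) - ENNReal.ofReal ((1 - ‖z‖) ^ Module.finrank ℝ E) *
            μ (Metric.ball 0 1) := by
          rw [measure_sdiff (Metric.ball_subset_ball (by simp)) measurableSet_ball.nullMeasurableSet
            measure_ball_lt_top.ne, Measure.addHaar_ball μ 0 (r := 1 - ‖z‖) (by linarith)]
      _ ≤ _ := by
          rw [tsub_le_iff_right, ← add_mul, ← ENNReal.ofReal_add (by positivity)
            (pow_nonneg (by linarith) _)]
          refine le_mul_of_one_le_left' (ENNReal.one_le_ofReal.2 ?_)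
          have := one_add_mul_le_pow (a := -‖z‖) (by linarith) (Module.finrank ℝ E)
          rw [← sub_eq_add_neg] at this
          linarith

theorem integral_Ioi_rpow_mul_min {s : ℝ} (hs0 : 0 < s) (hs1 : s < 1) :
    IntegrableOn (fun r : ℝ ↦ r ^ (-1 - s) * min 1 r) (Ioi 0) ∧
      ∫ r in Ioi (0 : ℝ), r ^ (-1 - s) * min 1 r = 1 / (s * (1 - s)) := by
  have e1 : EqOn (fun r : ℝ ↦ r ^ (-s)) (fun r : ℝ ↦ r ^ (-1 - s) * min 1 r) (Ioc 0 1) := by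
    intro r hr
    simp only
    rw [min_eq_right hr.2, ← rpow_add_one hr.1.ne']
    congr 1; ring
  have e2 : EqOn (fun r : ℝ ↦ r ^ (-1 - s)) (fun r : ℝ ↦ r ^ (-1 - s) * min 1 r) (Ioi 1) := by
    intro r hr
    simp only
    rw [min_eq_left (le_of_lt hr), mul_one]
  have i1 : IntegrableOn (fun r : ℝ ↦ r ^ (-1 - s) * min 1 r) (Ioc 0 1) :=
    ((intervalIntegrable_iff_integrableOn_Ioc_of_le zero_le_one).1
      (intervalIntegral.intervalIntegrable_rpow' (by linarith))).congr_fun e1 measurableSet_Ioc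
  have i2 : IntegrableOn (fun r : ℝ ↦ r ^ (-1 - s) * min 1 r) (Ioi 1) :=
    (integrableOn_Ioi_rpow_of_lt (by linarith) one_pos).congr_fun e2 measurableSet_Ioi
  rw [← Ioc_union_Ioi_eq_Ioi (zero_le_one' ℝ)]
  refine ⟨i1.union i2, ?_⟩
  rw [setIntegral_union Ioc_disjoint_Ioi_same measurableSet_Ioi i1 i2,
    ← setIntegral_congr_fun measurableSet_Ioc e1, ← setIntegral_congr_fun measurableSet_Ioi e2,
    ← intervalIntegral.integral_of_le zero_le_one, integral_rpow (Or.inl (by linarith)),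
    integral_Ioi_rpow_of_lt (by linarith) one_pos]
  have : 1 - s ≠ 0 := by linarith
  rw [one_rpow, one_rpow, zero_rpow (by linarith)]
  rw [show -s + 1 = 1 - s by ring, show -1 - s + 1 = - s by ring]
  field_simp
  ring

theorem integral_norm_rpow_mul_min [Nontrivial E] {s : ℝ} (hs0 : 0 < s) (hs1 : s < 1) :
    Integrable (fun z : E ↦ ‖z‖ ^ (-(Module.finrank ℝ E : ℝ) - s) * min 1 ‖z‖) μ ∧
      ∫ z, ‖z‖ ^ (-(Module.finrank ℝ E : ℝ) - s) * min 1 ‖z‖ ∂μ =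
        Module.finrank ℝ E * μ.real (Metric.ball 0 1) * (1 / (s * (1 - s))) := by
  obtain ⟨hint, hval⟩ := integral_Ioi_rpow_mul_min hs0 hs1
  have heq : EqOn (fun r : ℝ ↦ r ^ (-1 - s) * min 1 r) (fun r : ℝ ↦ r ^ (Module.finrank ℝ E - 1) •
      (r ^ (-(Module.finrank ℝ E : ℝ) - s) * min 1 r)) (Ioi 0) := by
    intro r hr
    have hd : 1 ≤ Module.finrank ℝ E := Module.finrank_pos
    simp only [smul_eq_mul]
    rw [← mul_assoc, ← rpow_natCast, ← rpow_add hr, Nat.cast_sub hd]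
    congr 2
    push_cast; ring
  refine ⟨(integrable_fun_norm_addHaar μ
    (f := fun r ↦ r ^ (-(Module.finrank ℝ E : ℝ) - s) * min 1 r)).2
      (hint.congr_fun heq measurableSet_Ioi), ?_⟩
  rw [integral_fun_norm_addHaar μ (fun r ↦ r ^ (-(Module.finrank ℝ E : ℝ) - s) * min 1 r),
    ← setIntegral_congr_fun measurableSet_Ioi heq, hval, nsmul_eq_mul, smul_eq_mul, mul_assoc]

end

theorem stmt_10 (n : ℕ) (hn : 2 ≤ n) :
    ∃ c : ℝ, 0 < c ∧ ∀ s : ℝ, 0 < s → s < 1 →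
      c / (s * (1 - s)) ≤
      ∫ x in Metric.ball (0 : EuclideanSpace ℝ (Fin (n - 1))) 1,
        ∫ y in (Metric.ball (0 : EuclideanSpace ℝ (Fin (n - 1))) 1)ᶜ,
          ‖x - y‖ ^ (1 - (n : ℝ) - s) := by
  have : Nonempty (Fin (n - 1)) := ⟨⟨0, by omega⟩⟩
  set E := EuclideanSpace ℝ (Fin (n - 1))
  set ω : ℝ := (volume : Measure E).real (Metric.ball 0 1)
  have hω : 0 < ω := ENNReal.toReal_pos (Metric.measure_ball_pos _ _ one_pos).ne'
    measure_ball_lt_top.ne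
  have hdim : (Module.finrank ℝ E : ℝ) = n - 1 := by
    rw [finrank_euclideanSpace_fin, Nat.cast_sub (by omega), Nat.cast_one]
  have hd : (0 : ℝ) < Module.finrank ℝ E := by exact_mod_cast Module.finrank_pos (R := ℝ) (M := E)
  refine ⟨Module.finrank ℝ E * ω * ω / 3, by positivity, fun s hs0 hs1 ↦ ?_⟩
  obtain ⟨hint, hval⟩ := integral_norm_rpow_mul_min (volume : Measure E) hs0 hs1
  have hexp : 1 - (n : ℝ) - s = -(Module.finrank ℝ E : ℝ) - s := by rw [hdim]; ring
  rw [hexp]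
  set p := -(Module.finrank ℝ E : ℝ) - s
  set B := Metric.ball (0 : E) 1
  have hg : Measurable fun z : E ↦ ENNReal.ofReal (‖z‖ ^ p) := by fun_prop
  have hfub := lintegral_lintegral_compl_sub (volume : Measure E) (A := B) measurableSet_ball hg
  have hFm : Measurable fun x : E ↦ ∫⁻ y in Bᶜ, ENNReal.ofReal (‖y - x‖ ^ p) :=
    Measurable.lintegral_prod_right' (f := fun q : E × E ↦ ENNReal.ofReal (‖q.2 - q.1‖ ^ p))
      (by fun_prop)
  have hlint : ∀ C : ℝ, 0 ≤ C → ∫⁻ z : E, ENNReal.ofReal (‖z‖ ^ p) *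
      (ENNReal.ofReal (C * min 1 ‖z‖) * volume B) =
      ENNReal.ofReal (C * ω * (Module.finrank ℝ E * ω * (1 / (s * (1 - s))))) := by
    intro C hC
    rw [← hval, ← integral_const_mul, ofReal_integral_eq_lintegral_ofReal (hint.const_mul _)
      (Filter.Eventually.of_forall fun z ↦ by positivity)]
    refine lintegral_congr fun z ↦ ?_
    rw [← ofReal_measureReal (measure_ball_lt_top (μ := (volume : Measure E)) (x := 0) (r := 1)).ne,
      ← ENNReal.ofReal_mul (by positivity), ← ENNReal.ofReal_mul (by positivity)]
    congr 1
    ring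
  have hfin : ∫⁻ x in B, ∫⁻ y in Bᶜ, ENNReal.ofReal (‖y - x‖ ^ p) ≠ ⊤ := by
    rw [hfub]
    refine ne_top_of_le_ne_top ?_
      (lintegral_mono fun z ↦ mul_le_mul_right (measure_exit_ball_le volume z) _)
    rw [hlint _ hd.le]
    exact ENNReal.ofReal_ne_top
  have hreal : ∫ x in B, ∫ y in Bᶜ, ‖x - y‖ ^ p =
      (∫⁻ x in B, ∫⁻ y in Bᶜ, ENNReal.ofReal (‖y - x‖ ^ p)).toReal := by
    rw [← integral_toReal hFm.aemeasurable (ae_lt_top hFm hfin)]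
    refine integral_congr_ae (Filter.Eventually.of_forall fun x ↦ ?_)
    simp only [norm_sub_rev x]
    exact integral_eq_lintegral_of_nonneg_ae (Filter.Eventually.of_forall fun y ↦ by positivity)
      (by fun_prop : Measurable fun y : E ↦ ‖y - x‖ ^ p).aestronglyMeasurable
  rw [hreal]
  refine (ENNReal.ofReal_le_iff_le_toReal hfin).1 ?_
  rw [hfub]
  calc _ = ∫⁻ z : E, ENNReal.ofReal (‖z‖ ^ p) *
        (ENNReal.ofReal (1 / 3 * min 1 ‖z‖) * volume B) := by
        rw [hlint _ (by norm_num)]; congr 1; ring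
    _ ≤ _ := lintegral_mono fun z ↦ by
        gcongr
        rw [one_div_mul_eq_div]
        exact le_measure_exit_ball volume z
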